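/- Let G be a finite simple graph in which every vertex has degree exactly 3, with n = |V(G)| = 2^m for some m ≥ 1, let k be an integer with 1 < k < n−1, and let G' (with weights, β, α and k' as specified) be the associated gadget graph. Then G has a vertex cover of size at most k if and only if wtd(G') ≤ k' = 3n + k + α + 2. -/

import Mathlib

/-- A treedepth decomposition of a simple graph `G`: a partial order `le` on the
vertices such that the set of elements below any vertex is linearly ordered, and
the endpoints of every edge are comparable. -/
structure TDDecomp {V : Type*} (G : SimpleGraph V) where
  le : V → V → Prop
  le_refl : ∀ x, le x x
  le_antisymm : ∀ x y, le x y → le y x → x = y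
  le_trans : ∀ x y z, le x y → le y z → le x z
  down_linear : ∀ x y z, le y x → le z x → le y z ∨ le z y
  adj_comparable : ∀ u v, G.Adj u v → le u v ∨ le v u

/-- A chain of a treedepth decomposition: a finite set of pairwise comparable vertices. -/
def TDDecomp.IsChain {V : Type*} {G : SimpleGraph V} (T : TDDecomp G) (C : Finset V) : Prop :=
  ∀ x ∈ C, ∀ y ∈ C, T.le x y ∨ T.le y x

/-- The weighted depth of a treedepth decomposition: the maximum over all chains `C`
of the total weight of `C`. -/
noncomputable def TDDecomp.weightedDepth {V : Type*} {G : SimpleGraph V}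
    (T : TDDecomp G) (w : V → ℕ) : ℕ :=
  sSup {s | ∃ C : Finset V, T.IsChain C ∧ s = C.sum w}

/-- The weighted treedepth of `G` with weight function `w`: the minimum weighted depth
over all treedepth decompositions of `G`. -/
noncomputable def wtd {V : Type*} (G : SimpleGraph V) (w : V → ℕ) : ℕ :=
  sInf {s | ∃ T : TDDecomp G, s = T.weightedDepth w}

/-- Vertices of the gadget graph `G'` built from a cubic graph `G` on `2^m` vertices:
`copy v i` is `v_{i+1}` (the two copies `v_1, v_2` of `v`), `guard v i` is `v_{g(i+1)}`
(the three vertices `v_{g1}, v_{g2}, v_{g3}`), and `tree t i j` is the `j`-th vertex at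
depth `i` of the complete binary tree `T_{t+1}` (depth `m` vertices are the `2^m` leaves). -/
inductive GadgetV (V : Type*) (m : ℕ) where
  | copy : V → Fin 2 → GadgetV V m
  | guard : V → Fin 3 → GadgetV V m
  | tree : Fin 3 → (i : Fin (m + 1)) → Fin (2 ^ i.val) → GadgetV V m

/-- The base relation generating the edges of `G'` (for `e : V ≃ Fin (2^m)` the
identification of `V(G)` with the leaves of each tree):
copies of adjacent vertices are adjacent (`u_1v_1, u_2v_2, u_1v_2, u_2v_1`);
each `v_{gi}` is adjacent to `v_1` and `v_2`; consecutive levels of each complete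
binary tree `T_t` are joined (child `j'` at depth `i+1` to parent `j'/2` at depth `i`);
and `v_1, v_{g1}` are joined to the leaf `v_{t_1}` of `T_1`, `v_2, v_{g2}` to the leaf
`v_{t_2}` of `T_2`, and `v_{g3}` to the leaf `v_{t_3}` of `T_3`. -/
def gadgetRel {V : Type*} {m : ℕ} (G : SimpleGraph V) (e : V ≃ Fin (2 ^ m)) :
    GadgetV V m → GadgetV V m → Prop
  | .copy u _, .copy v _ => G.Adj u v
  | .copy u _, .guard v _ => u = v
  | .copy u i, .tree t d j => (t : ℕ) = (i : ℕ) ∧ (d : ℕ) = m ∧ (j : ℕ) = (e u : ℕ)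
  | .guard u i, .tree t d j => (t : ℕ) = (i : ℕ) ∧ (d : ℕ) = m ∧ (j : ℕ) = (e u : ℕ)
  | .tree t d j, .tree t' d' j' => t = t' ∧ (d : ℕ) + 1 = (d' : ℕ) ∧ (j' : ℕ) / 2 = (j : ℕ)
  | _, _ => False

/-- The gadget graph `G'`. -/
def gadget {V : Type*} {m : ℕ} (G : SimpleGraph V) (e : V ≃ Fin (2 ^ m)) :
    SimpleGraph (GadgetV V m) :=
  SimpleGraph.fromRel (gadgetRel G e)

/-- The weight function of `G'` (with parameter `β`): copies `v_1, v_2` have weight `2`,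
the `v_{gi}` have weight `1`, and a tree vertex at depth `i` has weight `β + 3i`. -/
def gadgetW {V : Type*} {m : ℕ} (β : ℕ) : GadgetV V m → ℕ
  | .copy _ _ => 2
  | .guard _ _ => 1
  | .tree _ i _ => β + 3 * (i : ℕ)

namespace TDDecomp

variable {V : Type*} {G : SimpleGraph V} (T : TDDecomp G)

/-- `r` is the least element of `S`. -/
def IsRoot (S : Set V) (r : V) : Prop := r ∈ S ∧ ∀ y ∈ S, T.le r y

/-- `S` contains a chain of weight at least `c`. -/
def Heavy (w : V → ℕ) (S : Set V) (c : ℕ) : Prop :=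
  ∃ C : Finset V, (C : Set V) ⊆ S ∧ T.IsChain C ∧ c ≤ C.sum w

variable {T}

theorem isRoot_singleton (x : V) : T.IsRoot {x} x :=
  ⟨rfl, fun _ hy => hy ▸ T.le_refl x⟩

theorem IsRoot.union {A B : Set V} {r s a b : V} (hA : T.IsRoot A r) (hB : T.IsRoot B s)
    (ha : a ∈ A) (hb : b ∈ B) (hab : G.Adj a b) : ∃ q, T.IsRoot (A ∪ B) q := by
  have hrs : T.le r s ∨ T.le s r := by
    rcases T.adj_comparable a b hab with h | h
    · exact T.down_linear b r s (T.le_trans _ _ _ (hA.2 a ha) h) (hB.2 b hb)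
    · exact T.down_linear a r s (hA.2 a ha) (T.le_trans _ _ _ (hB.2 b hb) h)
  rcases hrs with h | h
  · exact ⟨r, Or.inl hA.1, fun y hy => hy.elim (hA.2 y)
      fun hy => T.le_trans _ _ _ h (hB.2 y hy)⟩
  · exact ⟨s, Or.inr hB.1, fun y hy => hy.elim
      (fun hy => T.le_trans _ _ _ h (hA.2 y hy)) (hB.2 y)⟩

theorem Heavy.mono {w : V → ℕ} {S S' : Set V} {c c' : ℕ} (h : T.Heavy w S c)
    (hS : S ⊆ S') (hc : c' ≤ c) : T.Heavy w S' c' := by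
  obtain ⟨C, h1, h2, h3⟩ := h
  exact ⟨C, h1.trans hS, h2, hc.trans h3⟩

theorem heavy_singleton (w : V → ℕ) (x : V) : T.Heavy w {x} (w x) :=
  ⟨{x}, by simp, by simp [IsChain, T.le_refl], by simp⟩

/-- A finite set of elements below a common lower bound of `S` extends any chain of `S`. -/
theorem Heavy.union {w : V → ℕ} {S : Set V} {c : ℕ} (h : T.Heavy w S c) {r : V}
    (hr : ∀ y ∈ S, T.le r y) {Y : Finset V} (hY : ∀ y ∈ Y, T.le y r)
    (hd : ∀ y ∈ Y, y ∉ S) : T.Heavy w (Y ∪ S) (Y.sum w + c) := by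
  classical
  obtain ⟨C, h1, h2, h3⟩ := h
  have hdis : Disjoint Y C := Finset.disjoint_left.2 fun y hy hy' => hd y hy (h1 hy')
  refine ⟨Y ∪ C, ?_, ?_, ?_⟩
  · rw [Finset.coe_union]
    exact Set.union_subset_union_right _ h1
  · intro x hx y hy
    rcases Finset.mem_union.1 hx with hx | hx <;> rcases Finset.mem_union.1 hy with hy | hy
    · exact T.down_linear r x y (hY x hx) (hY y hy)
    · exact Or.inl (T.le_trans _ _ _ (hY x hx) (hr y (h1 hy)))
    · exact Or.inr (T.le_trans _ _ _ (hY y hy) (hr x (h1 hx)))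
    · exact h2 x hx y hy
  · rw [Finset.sum_union hdis]
    exact Nat.add_le_add_left h3 _

theorem IsRoot.heavy {w : V → ℕ} {S S' : Set V} {c : ℕ} {r : V} (hr : T.IsRoot S r)
    (hS : S' ⊆ S) (hrS : r ∉ S') (h : T.Heavy w S' c) : T.Heavy w S (w r + c) := by
  refine (h.union (Y := {r}) (fun y hy => hr.2 y (hS hy)) ?_ ?_).mono ?_ (by simp)
  · simp [T.le_refl]
  · simpa using hrS
  · simpa [Set.insert_subset_iff] using ⟨hr.1, hS⟩

theorem sum_le_weightedDepth [Finite V] (w : V → ℕ) {C : Finset V} (hC : T.IsChain C) :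
    C.sum w ≤ T.weightedDepth w := by
  have := Fintype.ofFinite V
  refine le_csSup ⟨Finset.univ.sum w, ?_⟩ ⟨C, hC, rfl⟩
  rintro _ ⟨C, -, rfl⟩
  exact Finset.sum_le_sum_of_subset (Finset.subset_univ C)

theorem Heavy.le_weightedDepth [Finite V] {w : V → ℕ} {S : Set V} {c : ℕ}
    (h : T.Heavy w S c) : c ≤ T.weightedDepth w := by
  obtain ⟨C, -, h2, h3⟩ := h
  exact h3.trans (sum_le_weightedDepth w h2)

theorem weightedDepth_le {w : V → ℕ} {b : ℕ} (h : ∀ C : Finset V, T.IsChain C → C.sum w ≤ b) :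
    T.weightedDepth w ≤ b := by
  refine csSup_le ⟨0, ∅, by simp [IsChain], by simp⟩ ?_
  rintro _ ⟨C, hC, rfl⟩
  exact h C hC

theorem wtd_le_weightedDepth (T : TDDecomp G) (w : V → ℕ) : wtd G w ≤ T.weightedDepth w :=
  Nat.sInf_le ⟨T, rfl⟩

theorem exists_weightedDepth_eq_wtd (T : TDDecomp G) (w : V → ℕ) :
    ∃ T' : TDDecomp G, T'.weightedDepth w = wtd G w := by
  obtain ⟨T', hT'⟩ := Nat.sInf_mem (s := {s | ∃ T : TDDecomp G, s = T.weightedDepth w})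
    ⟨_, T, rfl⟩
  exact ⟨T', hT'.symm⟩

end TDDecomp

namespace GadgetV

variable {V : Type*} {m : ℕ}

instance [Finite V] : Finite (GadgetV V m) := by
  let f : (V × Fin 2) ⊕ (V × Fin 3) ⊕ (Fin 3 × (Σ i : Fin (m + 1), Fin (2 ^ i.val))) →
      GadgetV V m := fun x => match x with
    | .inl (v, i) => .copy v i
    | .inr (.inl (v, i)) => .guard v i
    | .inr (.inr (t, ⟨i, j⟩)) => .tree t i j
  refine Finite.of_surjective f ?_
  rintro (⟨v, i⟩ | ⟨v, i⟩ | ⟨t, i, j⟩)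
  · exact ⟨.inl (v, i), rfl⟩
  · exact ⟨.inr (.inl (v, i)), rfl⟩
  · exact ⟨.inr (.inr (t, ⟨i, j⟩)), rfl⟩

/-- Whether a vertex of the gadget graph lies in one of the three binary trees. -/
def IsTree : GadgetV V m → Prop
  | .tree _ _ _ => True
  | _ => False

/-- The `j`-th vertex of the `t`-th tree at depth `d`. -/
abbrev node (t : Fin 3) (d j : ℕ) (hd : d < m + 1) (hj : j < 2 ^ d) : GadgetV V m :=
  .tree t ⟨d, hd⟩ ⟨j, hj⟩

/-- The vertices of the subtree of the `t`-th tree below the `j`-th vertex at depth `d`. -/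
def subtree (V : Type*) (m : ℕ) (t : Fin 3) (d j : ℕ) : Set (GadgetV V m) :=
  {x | ∃ d' j' hd hj, x = node t d' j' hd hj ∧ d ≤ d' ∧ j' / 2 ^ (d' - d) = j}

variable {t : Fin 3} {d j : ℕ}

theorem node_mem_subtree (hd : d < m + 1) (hj : j < 2 ^ d) :
    node t d j hd hj ∈ subtree V m t d j :=
  ⟨d, j, hd, hj, rfl, le_rfl, by simp⟩

theorem isTree_of_mem_subtree {x : GadgetV V m} (hx : x ∈ subtree V m t d j) : x.IsTree := by
  obtain ⟨_, _, _, _, rfl, -⟩ := hx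
  trivial

theorem le_weight_of_mem_subtree {x : GadgetV V m} (hx : x ∈ subtree V m t d j) (β : ℕ) :
    β + 3 * d ≤ gadgetW β x := by
  obtain ⟨d', _, _, _, rfl, h, -⟩ := hx
  simp only [gadgetW]
  omega

theorem div_two_pow_succ_sub {d d' : ℕ} (h : d < d') (j : ℕ) :
    j / 2 ^ (d' - d) = j / 2 ^ (d' - (d + 1)) / 2 := by
  rw [Nat.div_div_eq_div_mul, ← pow_succ]
  congr 2
  omega

theorem subtree_succ_subset {c : ℕ} (hc : c / 2 = j) :
    subtree V m t (d + 1) c ⊆ subtree V m t d j := by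
  rintro _ ⟨d', j', hd, hj, rfl, h, h'⟩
  refine ⟨d', j', hd, hj, rfl, by omega, ?_⟩
  rw [div_two_pow_succ_sub (by omega), h', hc]

theorem notMem_subtree_of_ne {c c' : ℕ} {x : GadgetV V m} (hx : x ∈ subtree V m t d c)
    (hc : c ≠ c') : x ∉ subtree V m t d c' := by
  rintro ⟨d', j', hd, hj, rfl, h, h'⟩
  obtain ⟨d'', j'', hd', hj', he, h2, h3⟩ := hx
  simp only [node, tree.injEq, true_and] at he
  obtain ⟨he, he'⟩ := he
  obtain rfl : d' = d'' := by simpa using he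
  obtain rfl : j' = j'' := by simpa using he'
  exact hc (h3.symm.trans h')

theorem node_notMem_subtree_succ {c : ℕ} (hd : d < m + 1) (hj : j < 2 ^ d) :
    node t d j hd hj ∉ subtree V m t (d + 1) c := by
  rintro ⟨d', j', hd, hj, he, h, h'⟩
  simp only [node, tree.injEq, true_and] at he
  have : d = d' := by simpa using he.1
  omega

theorem mem_subtree_cases {x : GadgetV V m} (hx : x ∈ subtree V m t d j)
    (hd : d < m + 1) (hj : j < 2 ^ d) :
    x = node t d j hd hj ∨ ∃ c, c / 2 = j ∧ x ∈ subtree V m t (d + 1) c := by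
  obtain ⟨d', j', hd, hj, rfl, h, h'⟩ := hx
  rcases h.eq_or_lt with rfl | h
  · left
    simp only [Nat.sub_self, pow_zero, Nat.div_one] at h'
    subst h'
    rfl
  · exact Or.inr ⟨j' / 2 ^ (d' - (d + 1)), by rw [← h', div_two_pow_succ_sub h],
      d', j', hd, hj, rfl, h, rfl⟩

theorem disjoint_subtree_of_ne {t' : Fin 3} {d' j' : ℕ} (h : t ≠ t') {x : GadgetV V m}
    (hx : x ∈ subtree V m t d j) : x ∉ subtree V m t' d' j' := by
  rintro ⟨_, _, _, _, rfl, -⟩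
  obtain ⟨_, _, _, _, he, -⟩ := hx
  simp only [node, tree.injEq] at he
  exact h he.1.symm

section LowerBound

variable {G : SimpleGraph V} {e : V ≃ Fin (2 ^ m)} {T : TDDecomp (gadget G e)}

theorem adj_of_rel {x y : GadgetV V m} (hne : x ≠ y) (h : gadgetRel G e x y) :
    (gadget G e).Adj x y :=
  (SimpleGraph.fromRel_adj _ _ _).2 ⟨hne, Or.inl h⟩

theorem exists_isRoot_subtree (T : TDDecomp (gadget G e)) (t : Fin 3) (s : ℕ) :
    ∀ d j : ℕ, d + s = m → j < 2 ^ d → ∃ r, T.IsRoot (subtree V m t d j) r := by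
  induction s with
  | zero =>
    intro d j hd hj
    have hd' : d < m + 1 := by omega
    refine ⟨node t d j hd' hj, node_mem_subtree hd' hj, fun y hy => ?_⟩
    rcases mem_subtree_cases hy hd' hj with rfl | ⟨c, -, _, _, _, _, rfl, h, -⟩
    · exact T.le_refl _
    · omega
  | succ s ih =>
    intro d j hd hj
    have hd' : d < m + 1 := by omega
    have hc : ∀ c, c / 2 = j → c < 2 ^ (d + 1) := fun c hc => by rw [pow_succ]; omega
    have key : ∀ c, c / 2 = j → ∀ A r, T.IsRoot A r → node t d j hd' hj ∈ A →
        ∃ q, T.IsRoot (A ∪ subtree V m t (d + 1) c) q := by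
      intro c hcj A r hA hmem
      obtain ⟨r', hr'⟩ := ih (d + 1) c (by omega) (hc c hcj)
      refine hA.union hr' hmem (node_mem_subtree (by omega) (hc c hcj)) (adj_of_rel ?_ ?_)
      · simp [node]
      · exact ⟨rfl, rfl, hcj⟩
    obtain ⟨q, hq⟩ := key (2 * j) (by omega) _ _ (TDDecomp.isRoot_singleton _) rfl
    obtain ⟨q', hq'⟩ := key (2 * j + 1) (by omega) _ _ hq (Or.inl rfl)
    refine ⟨q', ?_⟩
    convert hq' using 1
    ext x
    constructor
    · intro hx
      rcases mem_subtree_cases hx hd' hj with rfl | ⟨c, hcj, hx⟩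
      · exact Or.inl (Or.inl rfl)
      · obtain rfl | rfl : c = 2 * j ∨ c = 2 * j + 1 := by omega
        · exact Or.inl (Or.inr hx)
        · exact Or.inr hx
    · rintro ((rfl | hx) | hx)
      · exact node_mem_subtree hd' hj
      · exact subtree_succ_subset (by omega) hx
      · exact subtree_succ_subset (by omega) hx

theorem heavy_subtree (T : TDDecomp (gadget G e)) (β : ℕ) (t : Fin 3) (s : ℕ) :
    ∀ d j : ℕ, d + s = m → j < 2 ^ d → T.Heavy (gadgetW β) (subtree V m t d j)
      (∑ i ∈ Finset.range (s + 1), (β + 3 * (d + i))) := by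
  induction s with
  | zero =>
    intro d j hd hj
    have hd' : d < m + 1 := by omega
    refine (TDDecomp.heavy_singleton _ (node t d j hd' hj)).mono
      (Set.singleton_subset_iff.2 (node_mem_subtree hd' hj)) ?_
    simp [gadgetW]
  | succ s ih =>
    intro d j hd hj
    obtain ⟨r, hr⟩ := exists_isRoot_subtree T t (s + 1) d j hd hj
    obtain ⟨c, hcj, hrc⟩ : ∃ c, c / 2 = j ∧ r ∉ subtree V m t (d + 1) c := by
      by_cases h : r ∈ subtree V m t (d + 1) (2 * j)
      · exact ⟨2 * j + 1, by omega, notMem_subtree_of_ne h (by omega)⟩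
      · exact ⟨2 * j, by omega, h⟩
    refine (hr.heavy (subtree_succ_subset hcj) hrc
      (ih (d + 1) c (by omega) (by rw [pow_succ]; omega))).mono subset_rfl ?_
    have := le_weight_of_mem_subtree hr.1 β
    rw [Finset.sum_range_succ']
    simp only [add_zero, add_assoc, add_comm, add_left_comm] at this ⊢
    omega

theorem exists_isRoot_insert_subtree (T : TDDecomp (gadget G e)) {z l : GadgetV V m} (s : ℕ)
    (hd : d + s = m) (hj : j < 2 ^ d) (hl : l ∈ subtree V m t d j)
    (hz : (gadget G e).Adj z l) : ∃ r, T.IsRoot (insert z (subtree V m t d j)) r := by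
  obtain ⟨r, hr⟩ := exists_isRoot_subtree T t s d j hd hj
  exact (TDDecomp.isRoot_singleton z).union hr rfl hl hz

/-- A light vertex attached to a leaf increases the depth of the tree by its weight. -/
theorem heavy_insert_subtree (T : TDDecomp (gadget G e)) (β : ℕ) (t : Fin 3)
    {z : GadgetV V m} (hz : ¬ z.IsTree) (hw : gadgetW β z ≤ 3) {l : ℕ} (hl : l < 2 ^ m)
    (hadj : (gadget G e).Adj z (node t m l (by omega) hl)) (s : ℕ) :
    ∀ d j : ℕ, d + s = m → j < 2 ^ d → l / 2 ^ (m - d) = j →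
      T.Heavy (gadgetW β) (insert z (subtree V m t d j))
        (∑ i ∈ Finset.range (s + 1), (β + 3 * (d + i)) + gadgetW β z) := by
  have hzn : ∀ d j, z ∉ subtree V m t d j := fun d j h => hz (isTree_of_mem_subtree h)
  induction s with
  | zero =>
    intro d j hd hj hlj
    obtain ⟨r, hr⟩ := exists_isRoot_insert_subtree T 0 hd hj
      ⟨m, l, by omega, hl, rfl, by omega, hlj⟩ hadj
    have hA := heavy_subtree T β t 0 d j hd hj
    by_cases hrz : r = z
    · subst hrz
      refine (hr.heavy (Set.subset_insert _ _) (hzn d j) hA).mono subset_rfl (by omega)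
    · have hmem := hr.1.resolve_left hrz
      have := le_weight_of_mem_subtree hmem β
      refine (hr.heavy (Set.singleton_subset_iff.2 (Set.mem_insert z _)) hrz
        (TDDecomp.heavy_singleton _ z)).mono subset_rfl ?_
      simpa using this
  | succ s ih =>
    intro d j hd hj hlj
    have hd' : d < m + 1 := by omega
    obtain ⟨r, hr⟩ := exists_isRoot_insert_subtree T (s + 1) hd hj
      ⟨m, l, by omega, hl, rfl, by omega, hlj⟩ hadj
    have hsum : ∑ i ∈ Finset.range (s + 1 + 1), (β + 3 * (d + i)) =
        ∑ i ∈ Finset.range (s + 1), (β + 3 * (d + 1 + i)) + (β + 3 * d) := by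
      rw [Finset.sum_range_succ']
      simp only [add_zero, add_assoc, add_comm 1]
    by_cases hrz : r = z
    · subst hrz
      refine (hr.heavy (Set.subset_insert _ _) (hzn d j)
        (heavy_subtree T β t (s + 1) d j hd hj)).mono subset_rfl (by omega)
    have hmem := hr.1.resolve_left hrz
    rcases mem_subtree_cases hmem hd' hj with rfl | ⟨c, hcj, hrc⟩
    · set c := l / 2 ^ (m - (d + 1)) with hc
      have hcj : c / 2 = j := by rw [← hlj, div_two_pow_succ_sub (by omega)]
      refine (hr.heavy (Set.insert_subset_insert (subtree_succ_subset hcj)) ?_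
        (ih (d + 1) c (by omega) (by rw [pow_succ]; omega) rfl)).mono subset_rfl ?_
      · rintro (h | h)
        · exact hrz h
        · exact node_notMem_subtree_succ hd' hj h
      · have := le_weight_of_mem_subtree hmem β
        omega
    · obtain ⟨c', hcj', hne⟩ : ∃ c', c' / 2 = j ∧ c ≠ c' := by
        by_cases h : c = 2 * j
        · exact ⟨2 * j + 1, by omega, by omega⟩
        · exact ⟨2 * j, by omega, h⟩
      have := le_weight_of_mem_subtree hrc β
      exact (hr.heavy ((subtree_succ_subset hcj').trans (Set.subset_insert _ _))
        (notMem_subtree_of_ne hrc hne)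
        (heavy_subtree T β t s (d + 1) c' (by omega) (by rw [pow_succ]; omega))).mono
        subset_rfl (by omega)

theorem le_of_roots_comparable [Finite V] (T : TDDecomp (gadget G e)) (β : ℕ) {t t' : Fin 3}
    (hne : t ≠ t') {r r' : GadgetV V m} (hr : T.IsRoot (subtree V m t 0 0) r)
    (hr' : T.IsRoot (subtree V m t' 0 0) r') (h : T.le r r') :
    β + ∑ i ∈ Finset.range (m + 1), (β + 3 * i) ≤ T.weightedDepth (gadgetW β) := by
  have hT := heavy_subtree T β t' m 0 0 (by omega) (by simp)
  have := (hT.union hr'.2 (Y := {r}) (by simpa using h)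
    (by simpa using disjoint_subtree_of_ne hne hr.1)).le_weightedDepth
  have hw := le_weight_of_mem_subtree hr.1 β
  simp only [zero_add, Finset.sum_singleton] at this
  omega

/-- A connected set of light vertices joining two trees contains a common ancestor of both trees,
provided that the roots of the trees are incomparable. -/
theorem exists_common_ancestor {t t' : Fin 3} {r r' : GadgetV V m}
    (hr : T.IsRoot (subtree V m t 0 0) r) (hr' : T.IsRoot (subtree V m t' 0 0) r')
    (hi : ¬ T.le r r') (hji : ¬ T.le r' r) {P : Set (GadgetV V m)} {q a a' b b' : GadgetV V m}
    (hP : T.IsRoot P q) (ha : a ∈ P) (hb : b ∈ P)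
    (ha' : a' ∈ subtree V m t 0 0) (hb' : b' ∈ subtree V m t' 0 0)
    (haa : (gadget G e).Adj a a') (hbb : (gadget G e).Adj b b') :
    ∃ x ∈ P, T.le x r ∧ T.le x r' := by
  obtain ⟨s, hs⟩ := hP.union hr ha ha' haa
  obtain ⟨x, hx⟩ := hs.union hr' (Or.inl hb) hb' hbb
  have hxr := hx.2 r (Or.inl (Or.inr hr.1))
  have hxr' := hx.2 r' (Or.inr hr'.1)
  rcases hx.1 with (h | h) | h
  · exact ⟨x, h, hxr, hxr'⟩
  · exact absurd (T.le_trans _ _ _ (hr.2 x h) hxr') hi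
  · exact absurd (T.le_trans _ _ _ (hr'.2 x h) hxr) hji

/-- The total weight of the copies and guards of `v` in `X`. -/
noncomputable def vertexWeight (X : Set (GadgetV V m)) (v : V) : ℕ :=
  open Classical in
  (∑ i : Fin 2, if copy v i ∈ X then 2 else 0) + ∑ i : Fin 3, if guard v i ∈ X then 1 else 0

/-- The total weight of the copies and guards in `X`. -/
noncomputable def lightWeight [Fintype V] (X : Set (GadgetV V m)) : ℕ :=
  ∑ v : V, vertexWeight X v

/-- The inclusion of the copies and guards into the gadget graph. -/
def light : V × (Fin 2 ⊕ Fin 3) ↪ GadgetV V m where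
  toFun x := match x with
    | (v, .inl i) => .copy v i
    | (v, .inr i) => .guard v i
  inj' := by
    rintro ⟨v, i | i⟩ ⟨v', i' | i'⟩ h <;> simp_all

@[simp] theorem light_inl (v : V) (i : Fin 2) : light (m := m) (v, .inl i) = copy v i := rfl

@[simp] theorem light_inr (v : V) (i : Fin 3) : light (m := m) (v, .inr i) = guard v i := rfl

theorem exists_finset_sum_eq_lightWeight [Fintype V] (β : ℕ) (X : Set (GadgetV V m)) :
    ∃ Y : Finset (GadgetV V m), (∀ x, x ∈ Y ↔ x ∈ X ∧ ¬ x.IsTree) ∧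
      Y.sum (gadgetW β) = lightWeight X := by
  classical
  refine ⟨(Finset.univ.filter fun x => light x ∈ X).map light, ?_, ?_⟩
  · rintro (⟨v, i⟩ | ⟨v, i⟩ | ⟨t, i, j⟩) <;>
      simp only [Finset.mem_map, Finset.mem_filter, Finset.mem_univ, true_and, Prod.exists,
        Sum.exists, light_inl, light_inr, IsTree] <;> aesop
  · rw [Finset.sum_map, Finset.sum_filter, Fintype.sum_prod_type]
    simp only [Fintype.sum_sum_type, light_inl, light_inr, gadgetW, lightWeight, vertexWeight]
    congr!

theorem lightWeight_add_pendant_le [Fintype V] (T : TDDecomp (gadget G e)) (β : ℕ) {t : Fin 3}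
    {r : GadgetV V m} (hr : T.IsRoot (subtree V m t 0 0) r) {X : Set (GadgetV V m)}
    (hX : ∀ x ∈ X, T.le x r) {z : GadgetV V m} (hz : ¬ z.IsTree) (hw : gadgetW β z ≤ 3)
    (hzX : z ∉ X) {l : ℕ} (hl : l < 2 ^ m)
    (hadj : (gadget G e).Adj z (node t m l (by omega) hl)) :
    lightWeight X + ∑ i ∈ Finset.range (m + 1), (β + 3 * i) + gadgetW β z ≤
      T.weightedDepth (gadgetW β) := by
  classical
  obtain ⟨Y, hY, hYw⟩ := exists_finset_sum_eq_lightWeight β X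
  by_cases hzr : T.le z r
  · have := ((heavy_subtree T β t m 0 0 (by omega) (by simp)).union hr.2
      (Y := insert z Y) ?_ ?_).le_weightedDepth
    · rw [Finset.sum_insert (by rw [hY]; tauto), hYw] at this
      simp only [zero_add] at this
      omega
    · intro y hy
      rcases Finset.mem_insert.1 hy with rfl | hy
      · exact hzr
      · exact hX y ((hY y).1 hy).1
    · intro y hy hyT
      rcases Finset.mem_insert.1 hy with rfl | hy
      · exact hz (isTree_of_mem_subtree hyT)
      · exact ((hY y).1 hy).2 (isTree_of_mem_subtree hyT)
  · have hl0 : l / 2 ^ (m - 0) = 0 := by simpa using Nat.div_eq_of_lt hl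
    obtain ⟨q, hq⟩ := exists_isRoot_insert_subtree T (d := 0) (j := 0) m (by omega) (by simp)
      ⟨m, l, by omega, hl, rfl, by omega, hl0⟩ hadj
    have hqr : T.le r q := by
      rcases hq.1 with rfl | h
      · exact absurd (hq.2 r (Or.inr hr.1)) hzr
      · exact hr.2 q h
    have := ((heavy_insert_subtree T β t hz hw hl hadj m 0 0 (by omega) (by simp) hl0).union
      (r := r) (fun y hy => T.le_trans _ _ _ hqr (hq.2 y hy)) (Y := Y)
      (fun y hy => hX y ((hY y).1 hy).1) ?_).le_weightedDepth
    · simp only [zero_add] at this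
      omega
    · rintro y hy (rfl | hyT)
      · exact hzX ((hY y).1 hy).1
      · exact ((hY y).1 hy).2 (isTree_of_mem_subtree hyT)

theorem lightWeight_add_tree_le [Fintype V] (T : TDDecomp (gadget G e)) (β : ℕ) {t : Fin 3}
    {r : GadgetV V m} (hr : T.IsRoot (subtree V m t 0 0) r) {X : Set (GadgetV V m)}
    (hX : ∀ x ∈ X, T.le x r) :
    lightWeight X + ∑ i ∈ Finset.range (m + 1), (β + 3 * i) ≤
      T.weightedDepth (gadgetW β) := by
  obtain ⟨Y, hY, hYw⟩ := exists_finset_sum_eq_lightWeight β X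
  have := ((heavy_subtree T β t m 0 0 (by omega) (by simp)).union hr.2 (Y := Y)
    (fun y hy => hX y ((hY y).1 hy).1)
    (fun y hy h => ((hY y).1 hy).2 (isTree_of_mem_subtree h))).le_weightedDepth
  simpa [hYw] using this

/-- Among the three sets of common ancestors of two of three vertices, one is the largest. -/
theorem exists_max_common_ancestors {W : Type*} {H : SimpleGraph W} (T : TDDecomp H)
    (r : Fin 3 → W) : ∃ a b, ((a = 0 ∧ b = 1) ∨ (a = 0 ∧ b = 2) ∨ (a = 1 ∧ b = 2)) ∧
      ∀ t t', t ≠ t' → ∀ x, T.le x (r t) → T.le x (r t') → T.le x (r a) ∧ T.le x (r b) := by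
  have key : ∀ a b c : Fin 3, (∀ x, T.le x (r a) → T.le x (r b) → T.le x (r c)) ∨
      ∀ x, T.le x (r a) → T.le x (r c) → T.le x (r b) := by
    intro a b c
    by_contra! h
    obtain ⟨⟨x, h1, h2, h3⟩, y, h4, h5, h6⟩ := h
    rcases T.down_linear _ _ _ h1 h4 with h | h
    · exact h3 (T.le_trans _ _ _ h h5)
    · exact h6 (T.le_trans _ _ _ h h2)
  have h0 := key 0 1 2
  have h1 := key 1 0 2
  have h2 := key 2 0 1
  by_cases h01 : ∀ x, (T.le x (r 0) → T.le x (r 2) → T.le x (r 1)) ∧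
      (T.le x (r 1) → T.le x (r 2) → T.le x (r 0))
  · refine ⟨0, 1, by simp, fun t t' hne x hx hx' => ?_⟩
    have := h01 x
    fin_cases t <;> fin_cases t' <;> simp_all
  by_cases h02 : ∀ x, (T.le x (r 0) → T.le x (r 1) → T.le x (r 2)) ∧
      (T.le x (r 1) → T.le x (r 2) → T.le x (r 0))
  · refine ⟨0, 2, by simp, fun t t' hne x hx hx' => ?_⟩
    have := h02 x
    fin_cases t <;> fin_cases t' <;> simp_all
  refine ⟨1, 2, by simp, fun t t' hne x hx hx' => ?_⟩
  have : (T.le x (r 0) → T.le x (r 1) → T.le x (r 2)) ∧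
      (T.le x (r 0) → T.le x (r 2) → T.le x (r 1)) := by
    clear hx hx'
    grind
  fin_cases t <;> fin_cases t' <;> simp_all

theorem four_le_vertexWeight {X : Set (GadgetV V m)} {v : V} {i : Fin 2}
    (h1 : copy v i ∈ X) (h2 : guard v i.castSucc ∈ X) (h3 : guard v 2 ∈ X) :
    4 ≤ vertexWeight X v := by
  rw [vertexWeight, Fin.sum_univ_two, Fin.sum_univ_three]
  fin_cases i <;> simp_all <;> omega

theorem five_le_vertexWeight {X : Set (GadgetV V m)} {v : V} {i j : Fin 2} (hij : i ≠ j)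
    (h1 : copy v i ∈ X) (h2 : guard v i.castSucc ∈ X) (h3 : guard v 2 ∈ X)
    (h4 : copy v j ∈ X ∨ guard v j.castSucc ∈ X) :
    5 ≤ vertexWeight X v := by
  rw [vertexWeight, Fin.sum_univ_two, Fin.sum_univ_three]
  fin_cases i <;> fin_cases j <;> rcases h4 with h4 | h4 <;> simp_all <;> omega

theorem six_le_vertexWeight {X : Set (GadgetV V m)} {v : V} (h1 : ∀ i : Fin 2, copy v i ∈ X)
    (h2 : ∀ i : Fin 2, guard v i.castSucc ∈ X) : 6 ≤ vertexWeight X v := by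
  rw [vertexWeight, Fin.sum_univ_two, Fin.sum_univ_three]
  have := h2 0
  have := h2 1
  simp_all
  omega

open Classical in
theorem three_add_le_vertexWeight {X : Set (GadgetV V m)} {v : V}
    (h : ∀ (i : Fin 2) (t : Fin 3), i.castSucc ≠ t → copy v i ∈ X ∨ guard v t ∈ X) :
    (3 + if copy v 0 ∈ X ∨ copy v 1 ∈ X then 1 else 0) ≤ vertexWeight X v := by
  have h01 := h 0 1 (by decide)
  have h02 := h 0 2 (by decide)
  have h10 := h 1 0 (by decide)
  have h12 := h 1 2 (by decide)
  clear h
  rw [vertexWeight, Fin.sum_univ_two, Fin.sum_univ_three]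
  by_cases h0 : copy v 0 ∈ X <;> by_cases h1 : copy v 1 ∈ X <;> simp_all <;> omega

theorem card_mul_le_lightWeight [Fintype V] {X : Set (GadgetV V m)} {c : ℕ}
    (h : ∀ v, c ≤ vertexWeight X v) : Fintype.card V * c ≤ lightWeight X := by
  simpa [lightWeight] using Finset.card_nsmul_le_sum Finset.univ (vertexWeight X) c fun v _ => h v

/-- The vertices with a copy in the largest set of common ancestors of two trees form a small
vertex cover. -/
theorem exists_cover_of_weightedDepth_le [Fintype V] (T : TDDecomp (gadget G e)) (k β : ℕ)
    (hk : k + 2 ≤ Fintype.card V) (hβ : β = 3 * Fintype.card V + k + 3)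
    (hT : T.weightedDepth (gadgetW β) ≤
      3 * Fintype.card V + k + ∑ i ∈ Finset.range (m + 1), (β + 3 * i) + 2) :
    ∃ C : Finset V, (∀ u v : V, G.Adj u v → u ∈ C ∨ v ∈ C) ∧ C.card ≤ k := by
  classical
  choose r hr using fun t => exists_isRoot_subtree T t m 0 0 (by omega) (by simp)
  have hinc : ∀ t t', t ≠ t' → ¬ T.le (r t) (r t') := fun t t' hne h => by
    have := le_of_roots_comparable T β hne (hr t) (hr t') h
    omega
  have hleaf : ∀ (t : Fin 3) (v : V), node t m (e v) (by omega) (e v).2 ∈ subtree V m t 0 0 :=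
    fun t v => ⟨m, e v, by omega, (e v).2, rfl, by omega, by simp [Nat.div_eq_of_lt (e v).2]⟩
  have hcl : ∀ (v : V) (i : Fin 2),
      (gadget G e).Adj (copy v i) (node i.castSucc m (e v) (by omega) (e v).2) :=
    fun v i => adj_of_rel (by simp [node]) ⟨rfl, rfl, rfl⟩
  have hgl : ∀ (v : V) (t : Fin 3),
      (gadget G e).Adj (guard v t) (node t m (e v) (by omega) (e v).2) :=
    fun v t => adj_of_rel (by simp [node]) ⟨rfl, rfl, rfl⟩
  have hedge : ∀ t t', t ≠ t' → ∀ x y x' y', (gadget G e).Adj x y →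
      x' ∈ subtree V m t 0 0 → y' ∈ subtree V m t' 0 0 →
      (gadget G e).Adj x x' → (gadget G e).Adj y y' →
      (T.le x (r t) ∧ T.le x (r t')) ∨ (T.le y (r t) ∧ T.le y (r t')) := by
    intro t t' hne x y x' y' hxy hx' hy' hxx hyy
    obtain ⟨q, hq⟩ := (TDDecomp.isRoot_singleton (T := T) x).union
      (TDDecomp.isRoot_singleton y) rfl rfl hxy
    obtain ⟨z, rfl | rfl, hz⟩ := exists_common_ancestor (hr t) (hr t') (hinc t t' hne)
      (hinc t' t hne.symm) hq (Or.inl rfl) (Or.inr rfl) hx' hy' hxx hyy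
    · exact Or.inl hz
    · exact Or.inr hz
  have hcg : ∀ (v : V) (i : Fin 2) (t : Fin 3), i.castSucc ≠ t →
      (T.le (copy v i) (r i.castSucc) ∧ T.le (copy v i) (r t)) ∨
        (T.le (guard v t) (r i.castSucc) ∧ T.le (guard v t) (r t)) := fun v i t hne =>
    hedge _ _ hne _ _ _ _ (adj_of_rel (by simp) rfl) (hleaf _ v) (hleaf _ v) (hcl v i) (hgl v t)
  have hcc : ∀ u v, G.Adj u v → (T.le (copy u 0) (r 0) ∧ T.le (copy u 0) (r 1)) ∨
      (T.le (copy v 1) (r 0) ∧ T.le (copy v 1) (r 1)) := fun u v huv =>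
    hedge 0 1 (by decide) _ _ _ _ (adj_of_rel (by simp) huv) (hleaf _ u) (hleaf _ v)
      (hcl u 0) (hcl v 1)
  have hcopy : ∀ (X : Set (GadgetV V m)) (i : Fin 2) (v : V), (∀ x ∈ X, T.le x (r i.castSucc)) →
      copy v i ∉ X → lightWeight X ≤ 3 * Fintype.card V + k := by
    intro X i v hX hv
    have := lightWeight_add_pendant_le T β (hr _) hX (z := copy v i) (by simp [IsTree])
      (by simp [gadgetW]) hv (e v).2 (hcl v i)
    simp only [gadgetW] at this
    omega
  have hguard : ∀ (X : Set (GadgetV V m)) (t : Fin 3) (v : V), (∀ x ∈ X, T.le x (r t)) →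
      guard v t ∉ X → lightWeight X ≤ 3 * Fintype.card V + k + 1 := by
    intro X t v hX hv
    have := lightWeight_add_pendant_le T β (hr _) hX (z := guard v t) (by simp [IsTree])
      (by simp [gadgetW]) hv (e v).2 (hgl v t)
    simp only [gadgetW] at this
    omega
  obtain ⟨a, b, hab, hmax⟩ := exists_max_common_ancestors T r
  set X : Set (GadgetV V m) := {x | T.le x (r a) ∧ T.le x (r b)}
  have hXa : ∀ x ∈ X, T.le x (r a) := fun x hx => hx.1
  have hXb : ∀ x ∈ X, T.le x (r b) := fun x hx => hx.2
  have hcgX : ∀ (v : V) (i : Fin 2) (t : Fin 3), i.castSucc ≠ t → copy v i ∈ X ∨ guard v t ∈ X :=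
    fun v i t hne => (hcg v i t hne).imp (fun h => hmax _ _ hne _ h.1 h.2)
      fun h => hmax _ _ hne _ h.1 h.2
  have hXw : lightWeight X ≤ 3 * Fintype.card V + k + 2 := by
    have := lightWeight_add_tree_le T β (hr a) hXa
    omega
  let C : Finset V := Finset.univ.filter fun v => copy v 0 ∈ X ∨ copy v 1 ∈ X
  have hCw : 3 * Fintype.card V + C.card ≤ lightWeight X := by
    refine le_trans (le_of_eq ?_)
      (Finset.sum_le_sum fun v (_ : v ∈ Finset.univ) => three_add_le_vertexWeight (hcgX v))
    simp only [C, Finset.sum_add_distrib, Finset.sum_boole, Finset.sum_const, Finset.card_univ,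
      smul_eq_mul, mul_comm, Nat.cast_id]
    congr!
  have h01 : (0 : Fin 3) ≠ 1 := by decide
  refine ⟨C, fun u v huv => ?_, ?_⟩
  · simp only [C, Finset.mem_filter, Finset.mem_univ, true_and]
    exact (hcc u v huv).imp (fun h => Or.inl (hmax _ _ h01 _ h.1 h.2))
      fun h => Or.inr (hmax _ _ h01 _ h.1 h.2)
  obtain ⟨i, rfl⟩ : ∃ i : Fin 2, i.castSucc = a := by
    rcases hab with h | h | h
    exacts [⟨0, h.1.symm⟩, ⟨0, h.1.symm⟩, ⟨1, h.1.symm⟩]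
  by_cases hC : ∃ v, v ∉ C
  · obtain ⟨v, hv⟩ := hC
    have hv' : copy v i ∉ X := fun h => hv <| by
      simp only [C, Finset.mem_filter, Finset.mem_univ, true_and]
      fin_cases i
      exacts [Or.inl h, Or.inr h]
    have := hcopy X i v hXa hv'
    omega
  exfalso
  have hCn : C.card = Fintype.card V :=
    (Finset.card_eq_iff_eq_univ C).2 (Finset.eq_univ_iff_forall.2 (not_exists_not.1 hC))
  have hca : ∀ v, copy v i ∈ X := fun v => by
    by_contra h
    have := hcopy X i v hXa h
    omega
  have hga : ∀ v, guard v i.castSucc ∈ X := fun v => by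
    by_contra h
    have := hguard X _ v hXa h
    omega
  have hgb : ∀ v, guard v b ∈ X := fun v => by
    by_contra h
    have := hguard X _ v hXb h
    omega
  obtain ⟨j, hij, hj⟩ : ∃ j : Fin 2, i ≠ j ∧ (b = j.castSucc ∨ b = 2) := by
    rcases hab with ⟨h, h'⟩ | ⟨h, h'⟩ | ⟨h, h'⟩ <;> fin_cases i <;> simp_all
  have hij2 : ∀ l : Fin 2, l = i ∨ l = j := by omega
  rcases hj with rfl | rfl
  · have hcb : ∀ v, copy v j ∈ X := fun v => by
      by_contra h
      have := hcopy X j v hXb h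
      omega
    have := card_mul_le_lightWeight (X := X) (c := 6) fun v => six_le_vertexWeight
      (fun l => by rcases hij2 l with rfl | rfl; exacts [hca v, hcb v])
      (fun l => by rcases hij2 l with rfl | rfl; exacts [hga v, hgb v])
    omega
  · have hnot : ∀ v, ¬ (copy v j ∈ X ∨ guard v j.castSucc ∈ X) := fun v h => by
      have := Finset.sum_lt_sum (s := Finset.univ) (f := fun _ => 4) (g := vertexWeight X)
        (fun v _ => four_le_vertexWeight (hca v) (hga v) (hgb v))
        ⟨v, Finset.mem_univ v, five_le_vertexWeight hij (hca v) (hga v) (hgb v) h⟩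
      simp only [Finset.sum_const, Finset.card_univ, smul_eq_mul] at this
      change _ < lightWeight X at this
      omega
    have hne : j.castSucc ≠ i.castSucc := fun h => hij (Fin.castSucc_injective _ h).symm
    have hne2 : ∀ l : Fin 2, l.castSucc ≠ 2 := by decide
    set Y : Set (GadgetV V m) := {x ∈ X | T.le x (r j.castSucc)}
    have hcY : ∀ v, copy v j ∉ Y := fun v h => hnot v (Or.inl h.1)
    have hYw : Fintype.card V * 4 ≤ lightWeight Y := by
      refine card_mul_le_lightWeight fun v => four_le_vertexWeight (i := i) ?_ ?_ ?_
      · refine ⟨hca v, ?_⟩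
        rcases hcg v i _ hne.symm with h | h
        · exact h.2
        · exact absurd (Or.inr (hmax _ _ hne.symm _ h.1 h.2)) (hnot v)
      · refine ⟨hga v, ?_⟩
        rcases hcg v j _ hne with h | h
        · exact absurd (Or.inl (hmax _ _ hne _ h.1 h.2)) (hnot v)
        · exact h.1
      · refine ⟨hgb v, ?_⟩
        rcases hcg v j _ (hne2 j) with h | h
        · exact absurd (Or.inl (hmax _ _ (hne2 j) _ h.1 h.2)) (hnot v)
        · exact h.1
    obtain ⟨v⟩ : Nonempty V := Fintype.card_pos_iff.1 (by omega)
    have := hcopy Y j v (fun x hx => hx.2) (hcY v)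
    omega

end LowerBound
section UpperBound

variable {G : SimpleGraph V} {e : V ≃ Fin (2 ^ m)}

/-- The depth of a tree vertex, or of the leaf a copy or guard is attached to. -/
def level : GadgetV V m → ℕ
  | .tree _ i _ => i
  | _ => m

/-- The position of a tree vertex, or of the leaf a copy or guard is attached to. -/
def position (e : V ≃ Fin (2 ^ m)) : GadgetV V m → ℕ
  | .copy v _ => e v
  | .guard v _ => e v
  | .tree _ _ j => j

/-- The index of the tree a vertex lies in or is attached to. -/
def treeIndex : GadgetV V m → ℕ
  | .copy _ i => i
  | .guard _ i => i
  | .tree t _ _ => t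

theorem eq_of_isTree {x y : GadgetV V m} (hx : x.IsTree) (hy : y.IsTree)
    (ht : treeIndex x = treeIndex y) (hl : level x = level y)
    (hp : position e x = position e y) : x = y := by
  rcases x with _ | _ | ⟨t, ⟨i, hi⟩, j⟩
  · exact hx.elim
  · exact hx.elim
  rcases y with _ | _ | ⟨t', ⟨i', hi'⟩, j'⟩
  · exact hy.elim
  · exact hy.elim
  obtain rfl : i = i' := hl
  obtain rfl : t = t' := Fin.ext ht
  obtain rfl : j = j' := Fin.ext hp
  rfl

/-- The order on the three trees with pendant copies and guards below their leaves. -/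
def Below (e : V ≃ Fin (2 ^ m)) (x y : GadgetV V m) : Prop :=
  x = y ∨ (x.IsTree ∧ treeIndex x = treeIndex y ∧ level x ≤ level y ∧
    position e y / 2 ^ (level y - level x) = position e x)

theorem Below.trans {x y z : GadgetV V m} (h : Below e x y) (h' : Below e y z) :
    Below e x z := by
  rcases h with rfl | ⟨h1, h2, h3, h4⟩
  · exact h'
  rcases h' with rfl | ⟨h1', h2', h3', h4'⟩
  · exact Or.inr ⟨h1, h2, h3, h4⟩
  · refine Or.inr ⟨h1, h2.trans h2', h3.trans h3', ?_⟩
    rw [← h4, ← h4', Nat.div_div_eq_div_mul, ← pow_add]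
    congr 2
    omega

theorem Below.antisymm {x y : GadgetV V m} (h : Below e x y) (h' : Below e y x) : x = y := by
  rcases h with rfl | ⟨h1, h2, h3, h4⟩
  · rfl
  rcases h' with rfl | ⟨h1', h2', h3', h4'⟩
  · rfl
  have := le_antisymm h3 h3'
  exact eq_of_isTree (e := e) h1 h1' h2 this (by simpa [this] using h4.symm)

theorem Below.linear {x y z : GadgetV V m} (h : Below e y x) (h' : Below e z x) :
    Below e y z ∨ Below e z y := by
  rcases h with rfl | ⟨h1, h2, h3, h4⟩
  · exact Or.inr h'
  rcases h' with rfl | ⟨h1', h2', h3', h4'⟩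
  · exact Or.inl (Or.inr ⟨h1, h2, h3, h4⟩)
  rcases le_total (level y) (level z) with hl | hl
  · refine Or.inl (Or.inr ⟨h1, h2.trans h2'.symm, hl, ?_⟩)
    rw [← h4, ← h4', Nat.div_div_eq_div_mul, ← pow_add]
    congr 2
    omega
  · refine Or.inr (Or.inr ⟨h1', h2'.trans h2.symm, hl, ?_⟩)
    rw [← h4, ← h4', Nat.div_div_eq_div_mul, ← pow_add]
    congr 2
    omega

theorem Below.eq_of_level_eq {x y : GadgetV V m} (hx : x.IsTree) (hy : y.IsTree)
    (h : Below e x y) (hl : level x = level y) : x = y := by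
  rcases h with rfl | ⟨-, h2, -, h4⟩
  · rfl
  · exact eq_of_isTree (e := e) hx hy h2 hl (by simpa [hl] using h4.symm)

/-- Both copies of the vertices in `C` and all guards of the other vertices. -/
def separator (C : Set V) : Set (GadgetV V m) :=
  {x | match x with
    | .copy v _ => v ∈ C
    | .guard v _ => v ∉ C
    | .tree _ _ _ => False}

theorem below_of_rel {C : Set V} (hC : ∀ u v, G.Adj u v → u ∈ C ∨ v ∈ C) {x y : GadgetV V m}
    (hx : x ∉ separator C) (hy : y ∉ separator C) (h : gadgetRel G e x y) :
    Below e x y ∨ Below e y x := by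
  rcases x with ⟨u, i⟩ | ⟨u, i⟩ | ⟨t, d, j⟩ <;> rcases y with ⟨v, i'⟩ | ⟨v, i'⟩ | ⟨t', d', j'⟩ <;>
    simp only [gadgetRel] at h
  · exact ((hC u v h).elim hx hy).elim
  · subst h
    exact (hy hx).elim
  · obtain ⟨h1, h2, h3⟩ := h
    exact Or.inr (Or.inr ⟨trivial, h1, h2.le, by simp [level, position, h2, h3]⟩)
  · obtain ⟨h1, h2, h3⟩ := h
    exact Or.inr (Or.inr ⟨trivial, h1, h2.le, by simp [level, position, h2, h3]⟩)
  · obtain ⟨rfl, h2, h3⟩ := h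
    exact Or.inl (Or.inr ⟨trivial, rfl, by simp only [level]; omega,
      by simp [level, position, ← h2, h3]⟩)

/-- The decomposition with the separator of a vertex cover on top of the three trees. -/
def coverDecomp {C : Set V} (hC : ∀ u v, G.Adj u v → u ∈ C ∨ v ∈ C) (f : GadgetV V m → ℕ)
    (hf : f.Injective) : TDDecomp (gadget G e) where
  le x y := (x ∈ separator C ∧ y ∈ separator C ∧ f x ≤ f y) ∨
    (x ∈ separator C ∧ y ∉ separator C) ∨
    (x ∉ separator C ∧ y ∉ separator C ∧ Below e x y)
  le_refl x := by
    have : Below e x x := Or.inl rfl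
    simp only [le_refl]
    tauto
  le_antisymm x y h h' := by
    by_cases hx : x ∈ separator C <;> by_cases hy : y ∈ separator C <;> simp_all
    · exact hf (le_antisymm h h')
    · exact h.antisymm h'
  le_trans x y z h h' := by
    by_cases hx : x ∈ separator C <;> by_cases hy : y ∈ separator C <;>
      by_cases hz : z ∈ separator C <;> simp_all
    · exact h.trans h'
    · exact h.trans h'
  down_linear x y z h h' := by
    by_cases hx : x ∈ separator C <;> by_cases hy : y ∈ separator C <;>
      by_cases hz : z ∈ separator C <;> simp_all
    · exact le_total _ _
    · exact le_total _ _
    · exact h.linear h'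
  adj_comparable x y h := by
    by_cases hx : x ∈ separator C <;> by_cases hy : y ∈ separator C <;> simp only [hx, hy] <;> simp
    · exact le_total _ _
    · rcases ((SimpleGraph.fromRel_adj _ _ _).1 h).2 with h | h
      · exact below_of_rel hC hx hy h
      · exact (below_of_rel hC hy hx h).symm

theorem lightWeight_separator [Fintype V] (C : Finset V) :
    lightWeight (separator (C : Set V) : Set (GadgetV V m)) = 3 * Fintype.card V + C.card := by
  classical
  have : ∀ v, vertexWeight (separator (C : Set V) : Set (GadgetV V m)) v =
      3 + if v ∈ C then 1 else 0 := fun v => by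
    rw [vertexWeight, Fin.sum_univ_two, Fin.sum_univ_three]
    by_cases h : v ∈ C <;> simp [separator, h]
  simp [lightWeight, this, Finset.sum_add_distrib, mul_comm]

theorem sum_isTree_le (β : ℕ) {D : Finset (GadgetV V m)} (hD : ∀ x ∈ D, x.IsTree)
    (hch : ∀ x ∈ D, ∀ y ∈ D, Below e x y ∨ Below e y x) :
    D.sum (gadgetW β) ≤ ∑ i ∈ Finset.range (m + 1), (β + 3 * i) := by
  have hinj : Set.InjOn level (D : Set (GadgetV V m)) := fun x hx y hy hxy =>
    (hch x hx y hy).elim (fun h => h.eq_of_level_eq (hD x hx) (hD y hy) hxy)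
      fun h => (h.eq_of_level_eq (hD y hy) (hD x hx) hxy.symm).symm
  calc D.sum (gadgetW β) = D.sum fun x => β + 3 * level x := by
        refine Finset.sum_congr rfl fun x hx => ?_
        have := hD x hx
        rcases x with _ | _ | _
        · exact this.elim
        · exact this.elim
        · rfl
    _ = ∑ i ∈ D.image level, (β + 3 * i) :=
        (Finset.sum_image (f := fun i => β + 3 * i) hinj).symm
    _ ≤ _ := by
        refine Finset.sum_le_sum_of_subset fun i hi => ?_
        obtain ⟨x, -, rfl⟩ := Finset.mem_image.1 hi
        rw [Finset.mem_range]
        rcases x with _ | _ | ⟨_, i, _⟩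
        · exact Nat.lt_succ_self m
        · exact Nat.lt_succ_self m
        · exact i.2

theorem sum_not_isTree_le (β : ℕ) {D : Finset (GadgetV V m)} (hD : ∀ x ∈ D, ¬ x.IsTree)
    (hch : ∀ x ∈ D, ∀ y ∈ D, Below e x y ∨ Below e y x) : D.sum (gadgetW β) ≤ 2 := by
  have hcard : D.card ≤ 1 := Finset.card_le_one.2 fun x hx y hy =>
    (hch x hx y hy).elim (fun h => h.resolve_right fun h => hD x hx h.1)
      fun h => (h.resolve_right fun h => hD y hy h.1).symm
  calc D.sum (gadgetW β) ≤ D.card • 2 := by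
        refine Finset.sum_le_card_nsmul _ _ _ fun x hx => ?_
        have := hD x hx
        rcases x with _ | _ | _
        · exact le_rfl
        · exact one_le_two
        · exact (this trivial).elim
    _ ≤ 2 := by simpa using Nat.mul_le_mul_right 2 hcard

theorem exists_weightedDepth_le [Fintype V] (e : V ≃ Fin (2 ^ m)) (β : ℕ) {C : Finset V}
    (hC : ∀ u v, G.Adj u v → u ∈ C ∨ v ∈ C) :
    ∃ T : TDDecomp (gadget G e), T.weightedDepth (gadgetW β) ≤
      3 * Fintype.card V + C.card + ∑ i ∈ Finset.range (m + 1), (β + 3 * i) + 2 := by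
  classical
  obtain ⟨f, hf⟩ := Countable.exists_injective_nat (GadgetV V m)
  refine ⟨coverDecomp (C := (C : Set V)) hC f hf, TDDecomp.weightedDepth_le fun D hD => ?_⟩
  obtain ⟨Y, hY, hYw⟩ := exists_finset_sum_eq_lightWeight β
    (separator (C : Set V) : Set (GadgetV V m))
  rw [lightWeight_separator] at hYw
  have hch : ∀ x ∈ D, x ∉ separator (C : Set V) → ∀ y ∈ D, y ∉ separator (C : Set V) →
      Below e x y ∨ Below e y x := fun x hx hx' y hy hy' => by
    simpa [coverDecomp, hx', hy'] using hD x hx y hy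
  rw [← Finset.sum_filter_add_sum_filter_not D (· ∈ separator (C : Set V)),
    ← Finset.sum_filter_add_sum_filter_not (D.filter (· ∉ separator (C : Set V))) IsTree,
    ← hYw, ← add_assoc]
  refine add_le_add (add_le_add (Finset.sum_le_sum_of_subset fun x hx => ?_) ?_) ?_
  · refine (hY x).2 ⟨(Finset.mem_filter.1 hx).2, fun h => ?_⟩
    rcases x with _ | _ | _
    exacts [h, h, (Finset.mem_filter.1 hx).2]
  · refine sum_isTree_le (e := e) β (fun x hx => (Finset.mem_filter.1 hx).2) fun x hx y hy => ?_
    simp only [Finset.mem_filter] at hx hy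
    exact hch x hx.1.1 hx.1.2 y hy.1.1 hy.1.2
  · refine sum_not_isTree_le (e := e) β (fun x hx => (Finset.mem_filter.1 hx).2)
      fun x hx y hy => ?_
    simp only [Finset.mem_filter] at hx hy
    exact hch x hx.1.1 hx.1.2 y hy.1.1 hy.1.2

end UpperBound

end GadgetV

/-- The cubic graph `G` has a vertex cover of size at most `k` if and
only if the gadget graph `G'` (with weights given by `β = 3n + k + 3`,
`α = Σ_{i=0}^{m} (β + 3i)`) satisfies `wtd G' ≤ k' = 3n + k + α + 2`. -/
theorem stmt13 {V : Type*} [Fintype V] (G : SimpleGraph V) (m : ℕ) (hm : 1 ≤ m)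
    (hcard : Fintype.card V = 2 ^ m) (e : V ≃ Fin (2 ^ m))
    (hdeg : ∀ v : V, (G.neighborSet v).ncard = 3)
    (k : ℕ) (hk1 : 1 < k) (hk2 : k < Fintype.card V - 1)
    (β α k' : ℕ)
    (hβ : β = 3 * Fintype.card V + k + 3)
    (hα : α = ∑ i ∈ Finset.range (m + 1), (β + 3 * i))
    (hk' : k' = 3 * Fintype.card V + k + α + 2) :
    (∃ C : Finset V, (∀ u v : V, G.Adj u v → u ∈ C ∨ v ∈ C) ∧ C.card ≤ k) ↔
      wtd (gadget G e) (gadgetW β) ≤ k' := by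
  subst hβ hα hk'
  constructor
  · rintro ⟨C, hC, hCk⟩
    obtain ⟨T, hT⟩ := GadgetV.exists_weightedDepth_le e (3 * Fintype.card V + k + 3) hC
    refine (T.wtd_le_weightedDepth _).trans (hT.trans ?_)
    gcongr
  · intro h
    obtain ⟨T₀, -⟩ := GadgetV.exists_weightedDepth_le (G := G) (C := Finset.univ) e 0 (by simp)
    obtain ⟨T, hT⟩ := T₀.exists_weightedDepth_eq_wtd (gadgetW (3 * Fintype.card V + k + 3))
    exact GadgetV.exists_cover_of_weightedDepth_le T k _ (by omega) rfl (hT ▸ h)
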